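/- Let n ≥ 2 and let a_1, …, a_{n−1} be integers with 0 ≤ a_1 ≤ a_2 ≤ … ≤ a_{n−1} and a_{n−1} ≥ 1. Set Σ_j := a_j + … + a_{n−1}. For each integer m ≥ 0, the set {x ∈ ℤ^{n−1} : ∀π ∈ S_{n−1}, ∀ε ∈ {±1}^{n−1}, ε_1a_1x_{π(1)} + … + ε_{n−1}a_{n−1}x_{π(n−1)} ≤ m} is finite; let N(m) denote its cardinality. Then the following identity holds in the formal power series ring ℤ[[t]]: (1−t) · ∏_{j=1}^{n−1}(1 − t^{Σ_j}) · Σ_{m≥0} N(m) t^m = Σ_{(π,ε) ∈ B_{n−1}} t^{Σ_{j ∈ D(π,ε)} Σ_j}. -/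

import Mathlib

open PowerSeries

/-- The generating function counting the elements of `α` by the weight `w`. -/
noncomputable def weightSeries {α : Type*} (w : α → ℕ) : PowerSeries ℤ :=
  PowerSeries.mk fun m => ({x | w x = m}.ncard : ℤ)

theorem finite_fiber {α : Type*} {w : α → ℕ} (hw : ∀ m, {x | w x ≤ m}.Finite) (m : ℕ) :
    {x | w x = m}.Finite :=
  (hw m).subset fun _ hx => le_of_eq hx

theorem weightSeries_comp_of_bijective {α β : Type*} (w : β → ℕ) {f : α → β}
    (hf : Function.Bijective f) : weightSeries (w ∘ f) = weightSeries w := by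
  ext m
  simp only [weightSeries, PowerSeries.coeff_mk]
  rw [← Set.ncard_image_of_injective _ hf.1]
  congr 2
  ext y
  obtain ⟨x, rfl⟩ := hf.2 y
  simp [hf.1.eq_iff]

theorem finite_mul_add_le {α : Type*} {w : α → ℕ} (hw : ∀ m, {x | w x ≤ m}.Finite)
    {s : ℕ} (hs : 1 ≤ s) (m : ℕ) : {p : ℕ × α | s * p.1 + w p.2 ≤ m}.Finite := by
  refine ((Set.finite_Iic m).prod (hw m)).subset fun p hp => ?_
  simp only [Set.mem_ofPred_eq, Set.mem_prod, Set.mem_Iic] at hp ⊢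
  constructor <;> nlinarith

theorem one_sub_X_pow_mul_weightSeries {α : Type*} {w : α → ℕ}
    (hw : ∀ m, {x | w x ≤ m}.Finite) {s : ℕ} (hs : 1 ≤ s) :
    (1 - PowerSeries.X ^ s) * weightSeries (fun p : ℕ × α => s * p.1 + w p.2) =
      weightSeries w := by
  have split (m : ℕ) : {p : ℕ × α | s * p.1 + w p.2 = m} =
      (fun x => ((0 : ℕ), x)) '' {x | w x = m} ∪
        (fun p : ℕ × α => (p.1 + 1, p.2)) '' {p | s * p.1 + w p.2 + s = m} := by
    ext ⟨u, x⟩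
    cases u <;> simp [mul_add, add_right_comm]
  have finite₂ (m : ℕ) : {p : ℕ × α | s * p.1 + w p.2 + s = m}.Finite :=
    (finite_mul_add_le hw hs m).subset fun p hp => by
      simp only [Set.mem_ofPred_eq] at hp ⊢
      omega
  ext m
  rw [sub_mul, one_mul, map_sub, PowerSeries.coeff_X_pow_mul']
  simp only [weightSeries, PowerSeries.coeff_mk]
  rw [split m, Set.ncard_union_eq _ ((finite_fiber hw m).image _) ((finite₂ m).image _),
    Set.ncard_image_of_injective _ (Prod.mk_right_injective 0), Set.ncard_image_of_injective]
  · split_ifs with h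
    · have : {p : ℕ × α | s * p.1 + w p.2 + s = m} = {p | s * p.1 + w p.2 = m - s} := by
        ext p
        simp only [Set.mem_ofPred_eq]
        omega
      rw [this]
      simp
    · have : {p : ℕ × α | s * p.1 + w p.2 + s = m} = ∅ := by
        ext p
        simp only [Set.mem_ofPred_eq, Set.mem_empty_iff_false, iff_false]
        omega
      rw [this]
      simp
  · rintro ⟨u, x⟩ ⟨v, y⟩ h
    simpa using h
  · rw [Set.disjoint_left]
    rintro _ ⟨x, -, rfl⟩ ⟨p, -, h⟩
    simp at h

theorem weightSeries_prod {α β : Type*} [Fintype β] (c : β → ℕ) {w : α → ℕ}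
    (hw : ∀ m, {x | w x ≤ m}.Finite) :
    weightSeries (fun p : β × α => c p.1 + w p.2) =
      (∑ b, PowerSeries.X ^ c b) * weightSeries w := by
  have finite₂ (b : β) (m : ℕ) : {x | c b + w x = m}.Finite :=
    (hw m).subset fun x hx => by
      simp only [Set.mem_ofPred_eq] at hx ⊢
      omega
  ext m
  have hcard : {p : β × α | c p.1 + w p.2 = m}.ncard = ∑ b, {x | c b + w x = m}.ncard := by
    have (b : β) : Finite {x | c b + w x = m} := finite₂ b m
    simp only [← Nat.card_coe_set_eq]
    rw [← Nat.card_sigma]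
    exact Nat.card_congr
      { toFun := fun p => ⟨p.1.1, p.1.2, p.2⟩
        invFun := fun q => ⟨(q.1, q.2.1), q.2.2⟩
        left_inv := fun _ => rfl
        right_inv := fun _ => rfl }
  rw [Finset.sum_mul, map_sum]
  simp only [PowerSeries.coeff_X_pow_mul', weightSeries, PowerSeries.coeff_mk, hcard,
    Nat.cast_sum]
  refine Finset.sum_congr rfl fun b _ => ?_
  split_ifs with h
  · congr 2
    ext x
    simp only [Set.mem_ofPred_eq]
    omega
  · have : {x | c b + w x = m} = ∅ := by
      ext x
      simp only [Set.mem_ofPred_eq, Set.mem_empty_iff_false, iff_false]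
      omega
    simp [this]

theorem finite_sum_mul_le {ι : Type*} [Fintype ι] {s : ι → ℕ} (hs : ∀ i, 1 ≤ s i) (m : ℕ) :
    {μ : ι → ℕ | ∑ i, s i * μ i ≤ m}.Finite := by
  classical
  refine (Set.finite_Iic fun _ : ι => m).subset fun μ hμ i => ?_
  calc μ i ≤ s i * μ i := Nat.le_mul_of_pos_left _ (hs i)
    _ ≤ ∑ i, s i * μ i :=
      Finset.single_le_sum (f := fun i => s i * μ i) (fun _ _ => Nat.zero_le _)
        (Finset.mem_univ i)
    _ ≤ m := hμ

theorem prod_one_sub_X_pow_mul_weightSeries {k : ℕ} {s : Fin k → ℕ} (hs : ∀ i, 1 ≤ s i) :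
    (∏ i, (1 - PowerSeries.X ^ s i)) *
      weightSeries (fun μ : Fin k → ℕ => ∑ i, s i * μ i) = 1 := by
  induction k with
  | zero =>
    ext m
    simp only [weightSeries, Finset.univ_eq_empty, Finset.prod_empty, Finset.sum_empty, one_mul,
      PowerSeries.coeff_mk, PowerSeries.coeff_one]
    rcases eq_or_ne m 0 with rfl | h
    · simp
    · simp [h, h.symm]
  | succ k ih =>
    have hs' (i : Fin k) : 1 ≤ s i.succ := hs i.succ
    have e := weightSeries_comp_of_bijective
      (fun μ : Fin (k + 1) → ℕ => ∑ i, s i * μ i) (Fin.consEquiv fun _ => ℕ).bijective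
    have : (fun μ : Fin (k + 1) → ℕ => ∑ i, s i * μ i) ∘ (Fin.consEquiv fun _ => ℕ) =
        fun p : ℕ × (Fin k → ℕ) => s 0 * p.1 + ∑ i, s i.succ * p.2 i := by
      ext p
      simp [Fin.sum_univ_succ, Fin.consEquiv]
    rw [← e, this, Fin.prod_univ_succ, mul_comm (1 - _), mul_assoc,
      one_sub_X_pow_mul_weightSeries (finite_sum_mul_le hs') (hs 0)]
    exact ih hs'

theorem one_sub_X_mul_mk_ncard_le {α : Type*} {w : α → ℕ} (hw : ∀ m, {x | w x ≤ m}.Finite) :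
    (1 - PowerSeries.X) * PowerSeries.mk (fun m => ({x | w x ≤ m}.ncard : ℤ)) =
      weightSeries w := by
  rw [← one_sub_X_pow_mul_weightSeries hw le_rfl, pow_one]
  congr 1
  ext m
  simp only [weightSeries, PowerSeries.coeff_mk]
  have : {p : ℕ × α | 1 * p.1 + w p.2 = m} = (fun x => (m - w x, x)) '' {x | w x ≤ m} := by
    ext ⟨u, x⟩
    simp only [Set.mem_ofPred_eq, Set.mem_image, Prod.mk.injEq, exists_eq_right_right]
    omega
  rw [this, Set.ncard_image_of_injective]
  exact fun x y h => (Prod.mk.inj h).2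

/-- The sign of an integer, with the sign of zero taken to be positive. -/
def unitSign (z : ℤ) : ℤˣ := if 0 ≤ z then 1 else -1

theorem unitSign_mul_natAbs (z : ℤ) : (unitSign z : ℤ) * z.natAbs = z := by
  unfold unitSign
  split_ifs <;> simp only [Units.val_one, Units.val_neg] <;> omega

theorem unitSign_mul_self (z : ℤ) : (unitSign z : ℤ) * z = z.natAbs := by
  unfold unitSign
  split_ifs <;> simp only [Units.val_one, Units.val_neg] <;> omega

theorem unitSign_units_mul {u : ℤˣ} {c : ℕ} (h : c = 0 → u = 1) :
    unitSign ((u : ℤ) * c) = u := by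
  unfold unitSign
  rcases Int.units_eq_one_or u with rfl | rfl
  · simp
  · have : c ≠ 0 := fun hc => by simpa using h hc
    rw [if_neg]
    simp
    omega

/-- The signed one-line notation of a signed permutation, with letters `±1, …, ±k`. -/
def signedVal {k : ℕ} (π : Equiv.Perm (Fin k)) (ε : Fin k → ℤˣ) (j : Fin k) : ℤ :=
  (ε j : ℤ) * ((π j : ℕ) + 1)

theorem signedVal_neg_iff {k : ℕ} {π : Equiv.Perm (Fin k)} {ε : Fin k → ℤˣ} {j : Fin k} :
    signedVal π ε j < 0 ↔ ε j ≠ 1 := by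
  unfold signedVal
  rcases Int.units_eq_one_or (ε j) with h | h <;> simp [h] <;> omega

theorem signedVal_injective {k : ℕ} (π : Equiv.Perm (Fin k)) (ε : Fin k → ℤˣ) :
    Function.Injective (signedVal π ε) := by
  intro i j h
  apply π.injective
  have := congrArg Int.natAbs h
  simp only [signedVal, Int.natAbs_mul, Int.units_natAbs, one_mul] at this
  omega

/-- The indicator function of the type B descent set of a signed permutation. -/
def descent {k : ℕ} (π : Equiv.Perm (Fin (k + 1))) (ε : Fin (k + 1) → ℤˣ) : Fin (k + 1) → ℕ :=
  Fin.cons (if signedVal π ε 0 < 0 then 1 else 0)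
    fun j => if signedVal π ε j.succ < signedVal π ε j.castSucc then 1 else 0

/-- The order in which the coordinates of an integer vector are sorted: by absolute value,
ties being broken by the signed index. -/
def sortKey {k : ℕ} (x : Fin k → ℤ) (i : Fin k) : ℕ ×ₗ ℤ :=
  toLex ((x i).natAbs, (unitSign (x i) : ℤ) * ((i : ℕ) + 1))

theorem sortKey_injective {k : ℕ} (x : Fin k → ℤ) : Function.Injective (sortKey x) := by
  intro i j h
  have := congrArg (fun p => (ofLex p).2.natAbs) h
  simp only [sortKey, ofLex_toLex, Int.natAbs_mul, Int.units_natAbs, one_mul] at this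
  omega

theorem monotone_natAbs_of_monotone_sortKey {k : ℕ} {x : Fin k → ℤ} {π : Equiv.Perm (Fin k)}
    (h : Monotone (sortKey x ∘ π)) : Monotone fun j => (x (π j)).natAbs := fun _ _ hij =>
  Prod.Lex.monotone_fst _ _ (h hij)

/-- The increments of `l` (starting from `0`) dominate the descent indicator of `(π, ε)`. -/
def DominatesDescents {k : ℕ} (π : Equiv.Perm (Fin (k + 1))) (ε : Fin (k + 1) → ℤˣ)
    (l : Fin (k + 1) → ℕ) : Prop :=
  descent π ε 0 ≤ l 0 ∧ ∀ j : Fin k, l j.castSucc + descent π ε j.succ ≤ l j.succ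

theorem DominatesDescents.sign_eq_one {k : ℕ} {π : Equiv.Perm (Fin (k + 1))}
    {ε : Fin (k + 1) → ℤˣ} {l : Fin (k + 1) → ℕ} (h : DominatesDescents π ε l)
    (j : Fin (k + 1)) : l j = 0 → ε j = 1 := by
  simp only [DominatesDescents, descent, Fin.cons_zero, Fin.cons_succ] at h
  induction j using Fin.induction with
  | zero =>
    intro h0
    have := h.1
    by_contra hε
    rw [if_pos (signedVal_neg_iff.2 hε)] at this
    omega
  | succ j ih =>
    intro h0
    have := h.2 j
    have hj := ih (by omega)
    by_contra hε
    have h1 := signedVal_neg_iff (π := π).2 hε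
    have h2 := mt (signedVal_neg_iff (π := π) (ε := ε) (j := j.castSucc)).1 (not_not.2 hj)
    rw [if_pos (by omega)] at this
    omega

theorem DominatesDescents.unitSign_eq {k : ℕ} {π : Equiv.Perm (Fin (k + 1))}
    {ε : Fin (k + 1) → ℤˣ} {l : Fin (k + 1) → ℕ} (h : DominatesDescents π ε l)
    {x : Fin (k + 1) → ℤ} (hx : ∀ j, x (π j) = ε j * l j) (j : Fin (k + 1)) :
    unitSign (x (π j)) = ε j := by
  rw [hx]
  exact unitSign_units_mul (h.sign_eq_one j)

theorem sortKey_eq {k : ℕ} {π : Equiv.Perm (Fin k)} {x : Fin k → ℤ} (j : Fin k) :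
    sortKey x (π j) =
      toLex ((x (π j)).natAbs, signedVal π (fun i => unitSign (x (π i))) j) := rfl

theorem monotone_sortKey_iff {k : ℕ} {π : Equiv.Perm (Fin (k + 1))} {x : Fin (k + 1) → ℤ} :
    Monotone (sortKey x ∘ π) ↔
      DominatesDescents π (fun j => unitSign (x (π j))) fun j => (x (π j)).natAbs := by
  have h0 : descent π (fun j => unitSign (x (π j))) 0 ≤ (x (π 0)).natAbs := by
    simp only [descent, Fin.cons_zero, signedVal_neg_iff, unitSign]
    split_ifs <;> simp_all
    omega
  rw [DominatesDescents, and_iff_right h0, Fin.monotone_iff_le_succ]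
  refine forall_congr' fun j => ?_
  have hne : signedVal π (fun i => unitSign (x (π i))) j.castSucc ≠
      signedVal π (fun i => unitSign (x (π i))) j.succ :=
    (signedVal_injective π _).ne j.castSucc_lt_succ.ne
  simp only [Function.comp_apply, sortKey_eq, Prod.Lex.toLex_le_toLex, descent, Fin.cons_succ]
  split_ifs <;> omega

theorem DominatesDescents.monotone_sortKey {k : ℕ} {π : Equiv.Perm (Fin (k + 1))}
    {ε : Fin (k + 1) → ℤˣ} {l : Fin (k + 1) → ℕ} (h : DominatesDescents π ε l)
    {x : Fin (k + 1) → ℤ} (hx : ∀ j, x (π j) = ε j * l j) : Monotone (sortKey x ∘ π) := by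
  rw [monotone_sortKey_iff]
  have h1 : (fun j => unitSign (x (π j))) = ε := funext (h.unitSign_eq hx)
  have h2 : (fun j => (x (π j)).natAbs) = l := by
    ext j
    simp [hx, Int.natAbs_mul]
  rwa [h1, h2]

theorem eq_of_monotone_sortKey {k : ℕ} {x : Fin k → ℤ} {π σ : Equiv.Perm (Fin k)}
    (hπ : Monotone (sortKey x ∘ π)) (hσ : Monotone (sortKey x ∘ σ)) : π = σ :=
  Equiv.ext fun j => sortKey_injective x (congrFun (Tuple.unique_monotone hπ hσ) j)

/-- The partial sums of the vector `μ` shifted by the descent indicator of `(π, ε)`. -/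
def shiftedSum {k : ℕ} (π : Equiv.Perm (Fin (k + 1))) (ε : Fin (k + 1) → ℤˣ)
    (μ : Fin (k + 1) → ℕ) (j : Fin (k + 1)) : ℕ :=
  ∑ i ∈ Finset.univ.filter (· ≤ j), (descent π ε i + μ i)

theorem shiftedSum_zero {k : ℕ} (π : Equiv.Perm (Fin (k + 1))) (ε : Fin (k + 1) → ℤˣ)
    (μ : Fin (k + 1) → ℕ) : shiftedSum π ε μ 0 = descent π ε 0 + μ 0 := by
  simp [shiftedSum, Finset.filter_eq']

theorem shiftedSum_succ {k : ℕ} (π : Equiv.Perm (Fin (k + 1))) (ε : Fin (k + 1) → ℤˣ)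
    (μ : Fin (k + 1) → ℕ) (j : Fin k) : shiftedSum π ε μ j.succ =
      shiftedSum π ε μ j.castSucc + (descent π ε j.succ + μ j.succ) := by
  have : Finset.univ.filter (· ≤ j.succ) =
      insert j.succ (Finset.univ.filter (· ≤ j.castSucc)) := by
    ext i
    simp only [Finset.mem_filter, Finset.mem_univ, true_and, Finset.mem_insert, Fin.le_def,
      Fin.ext_iff, Fin.val_succ, Fin.val_castSucc]
    omega
  rw [shiftedSum, this, Finset.sum_insert (by simp [Fin.le_def]), add_comm, shiftedSum]

theorem dominatesDescents_shiftedSum {k : ℕ} (π : Equiv.Perm (Fin (k + 1)))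
    (ε : Fin (k + 1) → ℤˣ) (μ : Fin (k + 1) → ℕ) :
    DominatesDescents π ε (shiftedSum π ε μ) := by
  refine ⟨?_, fun j => ?_⟩
  · rw [shiftedSum_zero]
    omega
  · rw [shiftedSum_succ]
    omega

theorem shiftedSum_injective {k : ℕ} (π : Equiv.Perm (Fin (k + 1))) (ε : Fin (k + 1) → ℤˣ) :
    Function.Injective (shiftedSum π ε) := by
  intro μ ν h
  ext j
  cases j using Fin.cases with
  | zero =>
    have := congrFun h 0
    simp only [shiftedSum_zero] at this
    omega
  | succ j =>
    have h1 := congrFun h j.succ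
    have h2 := congrFun h j.castSucc
    simp only [shiftedSum_succ] at h1
    omega

theorem DominatesDescents.exists_shiftedSum_eq {k : ℕ} {π : Equiv.Perm (Fin (k + 1))}
    {ε : Fin (k + 1) → ℤˣ} {l : Fin (k + 1) → ℕ} (h : DominatesDescents π ε l) :
    ∃ μ, shiftedSum π ε μ = l := by
  refine ⟨Fin.cons (l 0 - descent π ε 0)
    fun j => l j.succ - (l j.castSucc + descent π ε j.succ), ?_⟩
  ext j
  induction j using Fin.induction with
  | zero =>
    have := h.1
    rw [shiftedSum_zero, Fin.cons_zero]
    omega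
  | succ j ih =>
    have := h.2 j
    rw [shiftedSum_succ, ih, Fin.cons_succ]
    omega

/-- The integer vector whose sorted absolute values are `shiftedSum π ε μ`, placed and signed
according to `(π, ε)`. -/
def signedPoint {k : ℕ}
    (p : (Equiv.Perm (Fin (k + 1)) × (Fin (k + 1) → ℤˣ)) × (Fin (k + 1) → ℕ)) :
    Fin (k + 1) → ℤ := fun i =>
  p.1.2 (p.1.1.symm i) * shiftedSum p.1.1 p.1.2 p.2 (p.1.1.symm i)

theorem signedPoint_apply {k : ℕ} (π : Equiv.Perm (Fin (k + 1))) (ε : Fin (k + 1) → ℤˣ)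
    (μ : Fin (k + 1) → ℕ) (j : Fin (k + 1)) :
    signedPoint ((π, ε), μ) (π j) = ε j * shiftedSum π ε μ j := by
  simp [signedPoint]

theorem signedPoint_bijective {k : ℕ} : Function.Bijective (signedPoint (k := k)) := by
  constructor
  · rintro ⟨⟨π, ε⟩, μ⟩ ⟨⟨σ, δ⟩, ν⟩ h
    have hπ := signedPoint_apply π ε μ
    have hσ := signedPoint_apply σ δ ν
    rw [← h] at hσ
    obtain rfl := eq_of_monotone_sortKey
      ((dominatesDescents_shiftedSum π ε μ).monotone_sortKey hπ)
      ((dominatesDescents_shiftedSum σ δ ν).monotone_sortKey hσ)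
    obtain rfl : ε = δ := funext fun j => by
      rw [← (dominatesDescents_shiftedSum π ε μ).unitSign_eq hπ,
        (dominatesDescents_shiftedSum π δ ν).unitSign_eq hσ]
    obtain rfl : μ = ν := shiftedSum_injective π ε <| funext fun j => by
      simpa using (hπ j).symm.trans (hσ j)
    rfl
  · intro x
    obtain ⟨μ, hμ⟩ :=
      (monotone_sortKey_iff.1 (Tuple.monotone_sort (sortKey x))).exists_shiftedSum_eq
    refine ⟨((Tuple.sort (sortKey x), fun j => unitSign (x (Tuple.sort (sortKey x) j))), μ),
      funext fun i => ?_⟩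
    obtain ⟨j, rfl⟩ := (Tuple.sort (sortKey x)).surjective i
    rw [signedPoint_apply, hμ, unitSign_mul_natAbs]

/-- The pairing of `a` with the increasing rearrangement of the absolute values of `x`. -/
def sortedWeight {k : ℕ} (a : Fin k → ℕ) (x : Fin k → ℤ) : ℕ :=
  ∑ i, a i * (x (Tuple.sort (sortKey x) i)).natAbs

theorem sortedWeight_signedPoint {k : ℕ} (a : Fin (k + 1) → ℕ)
    (p : (Equiv.Perm (Fin (k + 1)) × (Fin (k + 1) → ℤˣ)) × (Fin (k + 1) → ℕ)) :
    sortedWeight a (signedPoint p) =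
      ∑ j, descent p.1.1 p.1.2 j * ∑ i ∈ Finset.univ.filter (j ≤ ·), a i +
        ∑ j, (∑ i ∈ Finset.univ.filter (j ≤ ·), a i) * p.2 j := by
  obtain ⟨⟨π, ε⟩, μ⟩ := p
  have hπ := signedPoint_apply π ε μ
  rw [sortedWeight, eq_of_monotone_sortKey (Tuple.monotone_sort _)
    ((dominatesDescents_shiftedSum π ε μ).monotone_sortKey hπ), ← Finset.sum_add_distrib]
  simp only [hπ, Int.natAbs_mul, Int.units_natAbs, one_mul, Int.natAbs_natCast, shiftedSum,
    Finset.mul_sum, Finset.sum_mul, ← Finset.sum_add_distrib, Finset.sum_filter]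
  rw [Finset.sum_comm]
  refine Finset.sum_congr rfl fun j _ => Finset.sum_congr rfl fun i _ => ?_
  split_ifs <;> ring

theorem forall_signed_sum_le_iff {k : ℕ} {a : Fin k → ℕ} (ha : Monotone a) (x : Fin k → ℤ)
    (m : ℕ) :
    (∀ (π : Equiv.Perm (Fin k)) (ε : Fin k → ℤˣ),
      ∑ i, (ε i : ℤ) * a i * x (π i) ≤ (m : ℤ)) ↔ sortedWeight a x ≤ m := by
  set σ := Tuple.sort (sortKey x)
  have hmono : Monotone fun j => (x (σ j)).natAbs :=
    monotone_natAbs_of_monotone_sortKey (Tuple.monotone_sort (sortKey x))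
  constructor
  · intro h
    have h1 := h σ fun i => unitSign (x (σ i))
    have h2 : ((sortedWeight a x : ℕ) : ℤ) =
        ∑ i, (unitSign (x (σ i)) : ℤ) * a i * x (σ i) := by
      rw [sortedWeight, Nat.cast_sum]
      refine Finset.sum_congr rfl fun i _ => ?_
      rw [Nat.cast_mul, mul_right_comm, unitSign_mul_self, mul_comm]
    exact_mod_cast h2.trans_le h1
  · intro h π ε
    have h1 : ∑ i, a i * (x (π i)).natAbs ≤ sortedWeight a x := by
      have := (ha.monovary hmono).sum_mul_comp_perm_le_sum_mul (σ := π.trans σ.symm)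
      simpa [sortedWeight] using this
    calc ∑ i, (ε i : ℤ) * a i * x (π i) ≤ ∑ i, ((a i * (x (π i)).natAbs : ℕ) : ℤ) := by
          refine Finset.sum_le_sum fun i _ => ?_
          refine (le_abs_self _).trans_eq ?_
          rw [Int.abs_eq_natAbs]
          simp [Int.natAbs_mul]
      _ ≤ m := by exact_mod_cast h1.trans h

/-- The type B descent identity for the weights `a`, and the finiteness of the sets
that it counts. -/
theorem ncard_sortedWeight_le_identity {k : ℕ} {a s : Fin (k + 1) → ℕ}
    (hs : ∀ j, s j = ∑ i ∈ Finset.univ.filter (j ≤ ·), a i) (hs1 : ∀ j, 1 ≤ s j) :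
    (∀ m, {x | sortedWeight a x ≤ m}.Finite) ∧
    (1 - PowerSeries.X) * (∏ j, (1 - PowerSeries.X ^ s j)) *
        PowerSeries.mk (fun m => ({x | sortedWeight a x ≤ m}.ncard : ℤ)) =
      ∑ π : Equiv.Perm (Fin (k + 1)), ∑ ε : Fin (k + 1) → ℤˣ,
        (PowerSeries.X : PowerSeries ℤ) ^ (∑ j, descent π ε j * s j) := by
  have hcomp : sortedWeight a ∘ signedPoint = fun p => ∑ j, descent p.1.1 p.1.2 j * s j +
      ∑ j, s j * p.2 j := by
    ext p
    simp only [Function.comp_apply, sortedWeight_signedPoint, hs]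
  have hfin (m : ℕ) : {x | sortedWeight a x ≤ m}.Finite := by
    refine ((Set.finite_univ.prod (finite_sum_mul_le hs1 m)).image signedPoint).subset ?_
    intro x hx
    obtain ⟨p, rfl⟩ := signedPoint_bijective.2 x
    have := congrFun hcomp p
    simp only [Function.comp_apply] at this
    refine ⟨p, ⟨Set.mem_univ _, ?_⟩, rfl⟩
    simp only [Set.mem_ofPred_eq] at hx ⊢
    omega
  refine ⟨hfin, ?_⟩
  rw [mul_comm (1 - PowerSeries.X), mul_assoc, one_sub_X_mul_mk_ncard_le hfin,
    ← weightSeries_comp_of_bijective _ signedPoint_bijective, hcomp,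
    weightSeries_prod (fun b : Equiv.Perm (Fin (k + 1)) × (Fin (k + 1) → ℤˣ) =>
      ∑ j, descent b.1 b.2 j * s j) (finite_sum_mul_le hs1), mul_left_comm,
    prod_one_sub_X_pow_mul_weightSeries hs1, mul_one, Fintype.sum_prod_type]

/-- univariate specialization of the type B generating
function. Indices are 0-based: the 0-based index `j` corresponds to the
1-based index `j+1`, so `S j = a_{j+1} + ⋯ + a_{n-1}` (1-based).
`val π ε j = ε_{j+1}·π(j+1)` encodes the signed one-line notation, and
`d π ε j` is the indicator that `j` lies in the descent set `D(π,ε)`.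
`A m` is the set of integer points in the `m`-th dilate of the symmetric
polytope and `N(m) = Nat.card (A m)` its cardinality. The identity
`(1-t)·∏_j (1-t^{Σ_j}) · Σ_m N(m) t^m = Σ_{(π,ε)} t^{Σ_{j ∈ D(π,ε)} Σ_j}`
holds in `ℤ[[t]]`. -/
theorem stmt_7 (n : ℕ) (hn : 2 ≤ n) (a : Fin (n - 1) → ℤ)
    (ha0 : ∀ i, 0 ≤ a i) (ha : Monotone a) (halast : 1 ≤ a ⟨n - 2, by omega⟩)
    (S : Fin (n - 1) → ℤ)
    (hS : ∀ j, S j = ∑ i ∈ Finset.univ.filter (fun i : Fin (n - 1) => (j : ℕ) ≤ (i : ℕ)), a i)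
    (val : Equiv.Perm (Fin (n - 1)) → (Fin (n - 1) → ℤˣ) → Fin (n - 1) → ℤ)
    (hval : ∀ π ε j, val π ε j = (ε j : ℤ) * ((π j : ℕ) + 1))
    (d : Equiv.Perm (Fin (n - 1)) → (Fin (n - 1) → ℤˣ) → Fin (n - 1) → ℕ)
    (hd : ∀ π ε j, d π ε j =
      if (j : ℕ) = 0 then (if val π ε j < 0 then 1 else 0)
      else (if val π ε j < val π ε ⟨(j : ℕ) - 1, by omega⟩ then 1 else 0))
    (A : ℕ → Set (Fin (n - 1) → ℤ))
    (hA : ∀ m, A m = {x | ∀ (π : Equiv.Perm (Fin (n - 1))) (ε : Fin (n - 1) → ℤˣ),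
      ∑ i, (ε i : ℤ) * a i * x (π i) ≤ (m : ℤ)}) :
    (∀ m, (A m).Finite) ∧
    (1 - PowerSeries.X) * (∏ j : Fin (n - 1), (1 - PowerSeries.X ^ (S j).toNat)) *
        PowerSeries.mk (fun m => (Nat.card (A m) : ℤ)) =
      ∑ π : Equiv.Perm (Fin (n - 1)), ∑ ε : Fin (n - 1) → ℤˣ,
        (PowerSeries.X : PowerSeries ℤ) ^ (∑ j : Fin (n - 1), d π ε j * (S j).toNat) := by
  obtain ⟨k, rfl⟩ : ∃ k, n = k + 2 := ⟨n - 2, by omega⟩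
  change Fin (k + 1) → ℤ at a S
  lift a to Fin (k + 1) → ℕ using ha0
  have hmono : Monotone a := fun i j hij => Nat.cast_le.1 (ha hij)
  have hs (j : Fin (k + 1)) :
      (S j).toNat = ∑ i ∈ Finset.univ.filter (j ≤ ·), a i := by
    rw [hS, ← Nat.cast_sum]
    rfl
  have hs1 (j : Fin (k + 1)) : 1 ≤ (S j).toNat := by
    rw [hs]
    calc 1 ≤ a (Fin.last k) := Nat.cast_le.1 halast
      _ ≤ _ := Finset.single_le_sum (fun _ _ => Nat.zero_le _) (by simp [Fin.le_last])
  have hval' (π ε) : val π ε = signedVal (k := k + 1) π ε := funext (hval π ε)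
  have hd' (π ε) : d π ε = descent (k := k) π ε := by
    ext j
    rw [hd, hval']
    cases j using Fin.cases <;> rfl
  have hA' (m) : A m = {x | sortedWeight (k := k + 1) a x ≤ m} := by
    rw [hA]
    exact Set.ext fun x => forall_signed_sum_le_iff hmono x m
  have main := ncard_sortedWeight_le_identity hs hs1
  simp only [hA', hd', Nat.card_coe_set_eq]
  exact main
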